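/- Local-to-global estimate: let Ω ⊂ ℝ^n be a bounded Boman domain with constant N ≥ 1 (with Whitney decomposition W(Ω) and chain decomposition with central cube Q_0), and let w be a doubling weight in Ω with constant D. If u ∈ L^1_loc(Ω; w dx) and 1 ≤ p < ∞, then ∫_Ω |u(x) − u_{w;Q_0*}|^p w(x) dx ≤ C(n, p, D, N) Σ_{Q∈W(Ω)} ∫_{Q*} |u(x) − u_{w;Q*}|^p w(x) dx. -/

import Mathlib

open MeasureTheory ENNReal NNReal Set

noncomputable section

/-- Euclidean space `ℝ^n`. -/
abbrev Rn (n : ℕ) := EuclideanSpace ℝ (Fin n)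

/-- The half-open cube `Q(x, r)` with midpoint `x` and side length `2r`. -/
def CubeC {n : ℕ} (x : Rn n) (r : ℝ) : Set (Rn n) :=
  {y | ∀ i, x i - r ≤ y i ∧ y i < x i + r}

/-- The weighted measure `w(E) = ∫_E w dx` of a set, as an extended nonnegative real. -/
def wMass {n : ℕ} (w : Rn n → ℝ) (E : Set (Rn n)) : ℝ≥0∞ :=
  ∫⁻ x in E, ENNReal.ofReal (w x)

/-- The measure `w dx`. -/
def wMeasure {n : ℕ} (w : Rn n → ℝ) : Measure (Rn n) :=
  volume.withDensity fun x => ENNReal.ofReal (w x)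

/-- The weighted average `u_{w;E} = w(E)⁻¹ ∫_E u w dx`. -/
def wAvg {n : ℕ} (w : Rn n → ℝ) (E : Set (Rn n)) (u : Rn n → ℝ) : ℝ :=
  ⨍ x in E, u x ∂(wMeasure w)

/-- A weight `w` is doubling in the open set `Ω` with constant `D`:
`w(Ω ∩ Q(x,2r)) ≤ D w(Ω ∩ Q(x,r))` for every cube `Q(x,r)` with midpoint `x ∈ Ω`. -/
def DoublingIn {n : ℕ} (Ω : Set (Rn n)) (w : Rn n → ℝ) (D : ℝ) : Prop :=
  ∀ x ∈ Ω, ∀ r : ℝ, 0 < r →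
    wMass w (Ω ∩ CubeC x (2 * r)) ≤ ENNReal.ofReal D * wMass w (Ω ∩ CubeC x r)

/-- The distance between two sets. -/
def setDist {n : ℕ} (A B : Set (Rn n)) : ℝ :=
  sInf {d : ℝ | ∃ x ∈ A, ∃ y ∈ B, d = dist x y}

/-- A Whitney decomposition of `Ω` with dimensional constant `Cdim`: a countable family of
pairwise disjoint half-open cubes covering `Ω`, such that the side length of each dilated
cube `Q* = (9/8)Q` is comparable (with constant `Cdim`) to its distance from `∂Ω`, and the
dilated cubes have overlap bounded by `Cdim`. -/
structure WhitneyDecomp (n : ℕ) (Ω : Set (Rn n)) (Cdim : ℝ) where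
  cubes : Set (Set (Rn n))
  countable : cubes.Countable
  center : Set (Rn n) → Rn n
  radius : Set (Rn n) → ℝ
  radius_pos : ∀ Q ∈ cubes, 0 < radius Q
  eq_cube : ∀ Q ∈ cubes, Q = CubeC (center Q) (radius Q)
  pairwise_disjoint : cubes.PairwiseDisjoint id
  union_eq : ⋃₀ cubes = Ω
  dist_lower : ∀ Q ∈ cubes,
    9 / 4 * radius Q ≤ Cdim * setDist (CubeC (center Q) (9 / 8 * radius Q)) (frontier Ω)
  dist_upper : ∀ Q ∈ cubes,
    setDist (CubeC (center Q) (9 / 8 * radius Q)) (frontier Ω) ≤ Cdim * (9 / 4 * radius Q)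
  overlap_finite : ∀ x : Rn n, {Q ∈ cubes | x ∈ CubeC (center Q) (9 / 8 * radius Q)}.Finite
  overlap_le : ∀ x : Rn n,
    (({Q ∈ cubes | x ∈ CubeC (center Q) (9 / 8 * radius Q)}).ncard : ℝ) ≤ Cdim

/-- The dilated Whitney cube `Q* = (9/8)Q`. -/
def Qstar {n : ℕ} {Ω : Set (Rn n)} {Cdim : ℝ} (W : WhitneyDecomp n Ω Cdim)
    (Q : Set (Rn n)) : Set (Rn n) :=
  CubeC (W.center Q) (9 / 8 * W.radius Q)

/-- Two Whitney cubes `P, Q` are chained (with constant `c`) if there is a cube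
`R ⊆ P* ∩ Q*` with `l(R) ≥ c · max{l(P*), l(Q*)}`. -/
def ChainLink {n : ℕ} {Ω : Set (Rn n)} {Cdim : ℝ} (W : WhitneyDecomp n Ω Cdim) (c : ℝ)
    (P Q : Set (Rn n)) : Prop :=
  ∃ (z : Rn n) (r : ℝ), 0 < r ∧ CubeC z r ⊆ Qstar W P ∩ Qstar W Q ∧
    c * max (2 * (9 / 8 * W.radius P)) (2 * (9 / 8 * W.radius Q)) ≤ 2 * r

/-- `L` is a chain of Whitney cubes joining `P` to `Q`: a list of distinct Whitney cubes
starting at `P`, ending at `Q`, whose consecutive members are chained. -/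
def IsChainFrom {n : ℕ} {Ω : Set (Rn n)} {Cdim : ℝ} (W : WhitneyDecomp n Ω Cdim) (c : ℝ)
    (P Q : Set (Rn n)) (L : List (Set (Rn n))) : Prop :=
  (∀ R ∈ L, R ∈ W.cubes) ∧ L.Nodup ∧ L.head? = some P ∧ L.getLast? = some Q ∧
    L.Chain' (ChainLink W c)

/-- A Boman chain decomposition of `Ω` with constants `Cdim` (Whitney), `cdim` (chain link)
and `N` (Boman): a Whitney decomposition together with a chain decomposition with common
central cube such that the shadow of each `R` is contained in `NR`. -/
structure BomanDecomp (n : ℕ) (Ω : Set (Rn n)) (Cdim cdim N : ℝ)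
    extends WhitneyDecomp n Ω Cdim where
  central : Set (Rn n)
  central_mem : central ∈ cubes
  chain : Set (Rn n) → List (Set (Rn n))
  chain_isChain : ∀ Q ∈ cubes, IsChainFrom toWhitneyDecomp cdim central Q (chain Q)
  shadow_subset : ∀ R ∈ cubes, ∀ Q ∈ cubes, R ∈ chain Q →
    Q ⊆ CubeC (center R) (N * radius R)

theorem ENNReal.add_rpow_le_rpow_add_mul {p : ℝ} (hp : 1 ≤ p) (a s : ℝ≥0∞) :
    (a + s) ^ p ≤ s ^ p + ENNReal.ofReal p * a * (a + s) ^ (p - 1) := by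
  have hp0 : 0 < p := by linarith
  have hq : 0 ≤ p - 1 := by linarith
  have hofp : ENNReal.ofReal p ≠ 0 := by simpa using hp0
  by_cases hs : s = ⊤
  · simp [hs, hp0]
  by_cases ha : a = ⊤
  · subst ha
    rw [ENNReal.mul_top hofp, top_add]
    rcases hq.eq_or_lt with h | h
    · simp [← h]
    · simp [h]
  by_cases h0 : a + s = 0
  · simp [h0, hp0]
  lift a to ℝ≥0 using ha
  lift s to ℝ≥0 using hs
  rw [ENNReal.ofReal]
  rw [← ENNReal.coe_add] at *
  rw [← ENNReal.coe_rpow_of_nonneg _ hp0.le, ← ENNReal.coe_rpow_of_nonneg _ hp0.le,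
    ← ENNReal.coe_rpow_of_nonneg _ hq]
  norm_cast
  rw [← NNReal.coe_le_coe]
  push_cast
  rw [Real.coe_toNNReal _ hp0.le]
  have ht : (0 : ℝ) < a + s := by
    have : a + s ≠ 0 := by exact_mod_cast h0
    exact_mod_cast pos_iff_ne_zero.mpr this
  set t : ℝ := a + s with htdef
  have ha0 : (0 : ℝ) ≤ a := a.2
  have hs0 : (0 : ℝ) ≤ s := s.2
  have hb := one_add_mul_self_le_rpow_one_add (s := -(a / t : ℝ)) (by
    rw [neg_le_neg_iff, div_le_one ht]; linarith) hp
  have h1 : (1 + -(a / t : ℝ)) = s / t := by field_simp; linarith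
  rw [h1, Real.div_rpow hs0 ht.le, le_div_iff₀ (Real.rpow_pos_of_pos ht _)] at hb
  have h2 : t ^ p = t ^ (p - 1) * t := by
    rw [← Real.rpow_add_one ht.ne']; ring_nf
  have h3 : (1 + p * -(a / t : ℝ)) * t ^ p = t ^ p - p * a * t ^ (p - 1) := by
    rw [h2]; field_simp; ring
  linarith

theorem ENNReal.sum_rpow_le_mul_sum_mul_rpow {ι : Type*} {p : ℝ} (hp : 1 ≤ p) (F : Finset ι)
    (r : ι → ℝ) (a : ι → ℝ≥0∞) :
    (∑ i ∈ F, a i) ^ p ≤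
      ENNReal.ofReal p * ∑ i ∈ F, a i * (∑ j ∈ F with r i ≤ r j, a j) ^ (p - 1) := by
  classical
  have hp0 : 0 < p := by linarith
  have hq : 0 ≤ p - 1 := by linarith
  induction F using Finset.induction_on_min_value r with
  | empty => simp [hp0]
  | insert b s hb hmin ih =>
    rw [Finset.sum_insert hb, Finset.sum_insert hb, mul_add, add_comm (ENNReal.ofReal p * _)]
    have h1 : Finset.filter (fun j => r b ≤ r j) (insert b s) = insert b s := by
      apply Finset.filter_true_of_mem
      intro x hx
      rcases Finset.mem_insert.1 hx with rfl | hx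
      · exact le_rfl
      · exact hmin x hx
    rw [h1, Finset.sum_insert hb]
    refine (ENNReal.add_rpow_le_rpow_add_mul hp _ _).trans (add_le_add (ih.trans ?_) ?_)
    · gcongr
      exact Finset.subset_insert _ _
    · rw [mul_assoc]

theorem ENNReal.mul_rpow_sub_one_le {p : ℝ} (hp : 1 ≤ p) (a b : ℝ≥0∞) {M : ℝ≥0∞}
    (hM : M ≠ 0) (hM' : M ≠ ⊤) :
    a * b ^ (p - 1) ≤ M ^ (p - 1) * a ^ p + M⁻¹ * b ^ p := by
  have hq : 0 ≤ p - 1 := by linarith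
  have key : ∀ x : ℝ≥0∞, x ^ p = x * x ^ (p - 1) := fun x => by
    conv_lhs => rw [show p = 1 + (p - 1) by ring]
    rw [ENNReal.rpow_add_of_nonneg _ _ zero_le_one hq, ENNReal.rpow_one]
  rcases le_total b (M * a) with h | h
  · refine le_trans ?_ le_self_add
    calc a * b ^ (p - 1) ≤ a * (M * a) ^ (p - 1) := by gcongr
      _ = M ^ (p - 1) * a ^ p := by
        rw [key a, ENNReal.mul_rpow_of_nonneg _ _ hq]; ring
  · refine le_trans ?_ le_add_self
    have : a ≤ M⁻¹ * b := by
      rw [mul_comm, ← div_eq_mul_inv, ENNReal.le_div_iff_mul_le (.inl hM) (.inl hM'), mul_comm]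
      exact h
    calc a * b ^ (p - 1) ≤ M⁻¹ * b * b ^ (p - 1) := by gcongr
      _ = _ := by rw [key b]; ring

/-- A weighted overlap estimate for families of sets which absorb smaller members. -/
theorem lintegral_sum_indicator_rpow_le {X ι : Type*} [MeasurableSpace X] {ν : Measure X}
    [IsFiniteMeasure ν] {p : ℝ} (hp : 1 ≤ p) (F : Finset ι) (R : ι → Set X)
    (E : ℕ → ι → Set X) (r : ι → ℝ) (a : ι → ℝ≥0∞) {K A : ℝ≥0∞} (hK : K ≠ 0) (hK' : K ≠ ⊤)
    (hA : 1 ≤ A) (hA' : A ≠ ⊤) (ha : ∀ i ∈ F, a i ≠ ⊤)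
    (hRm : ∀ i ∈ F, MeasurableSet (R i)) (hEm : ∀ k, ∀ i ∈ F, MeasurableSet (E k i))
    (hR : (F : Set ι).PairwiseDisjoint R) (hRE : ∀ k, ∀ i ∈ F, R i ⊆ E k i)
    (habs : ∀ k, ∀ i ∈ F, ∀ j ∈ F, r i ≤ r j → (E k i ∩ E k j).Nonempty → E k i ⊆ E (k + 1) j)
    (hν : ∀ k, ∀ i ∈ F, ν (E k i) ≤ K * A ^ k * ν (R i)) :
    ∫⁻ x, (∑ i ∈ F, (E 0 i).indicator (fun _ => a i) x) ^ p ∂ν ≤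
      2 * (ENNReal.ofReal p * K * (2 * ENNReal.ofReal p * K * A ^ p) ^ (p - 1)) *
        ∑ i ∈ F, a i ^ p * ν (R i) := by
  classical
  have hp0 : 0 < p := by linarith
  have hq : 0 ≤ p - 1 := by linarith
  have hofp : ENNReal.ofReal p ≠ 0 := by simpa using hp0
  set P := ENNReal.ofReal p with hP
  have hP' : P ≠ ⊤ := ENNReal.ofReal_ne_top
  set I : ℕ → ℝ≥0∞ := fun k => ∫⁻ x, (∑ i ∈ F, (E k i).indicator (fun _ => a i) x) ^ p ∂ν with hI
  set J : ℝ≥0∞ := ∑ i ∈ F, a i ^ p * ν (R i) with hJ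
  have hA0 : A ≠ 0 := (zero_lt_one.trans_le hA).ne'
  set B : ℝ≥0∞ := A ^ p with hB
  have hB1 : 1 ≤ B := ENNReal.one_le_rpow hA hp0
  have hB0 : B ≠ 0 := (zero_lt_one.trans_le hB1).ne'
  have hB' : B ≠ ⊤ := ENNReal.rpow_ne_top_of_nonneg hp0.le hA'
  have hstep : ∀ k, ∀ M : ℝ≥0∞, M ≠ 0 → M ≠ ⊤ →
      I k ≤ P * K * A ^ k * (M ^ (p - 1) * J + M⁻¹ * I (k + 1)) := by
    intro k M hM hM'
    set α : ι → ℝ≥0∞ := fun i => ∑ j ∈ F with E k i ⊆ E (k + 1) j, a j with hα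
    have hpt : ∀ x, (∑ i ∈ F, (E k i).indicator (fun _ => a i) x) ^ p ≤
        P * ∑ i ∈ F, (E k i).indicator (fun _ => a i * α i ^ (p - 1)) x := by
      intro x
      refine (ENNReal.sum_rpow_le_mul_sum_mul_rpow hp F r _).trans ?_
      gcongr with i hi
      by_cases hx : x ∈ E k i
      · simp only [indicator_of_mem hx]
        gcongr
        rw [hα]
        simp only [Finset.sum_filter]
        refine Finset.sum_le_sum fun j hj => ?_
        by_cases hr : r i ≤ r j
        · by_cases hxj : x ∈ E k j
          · rw [if_pos hr, if_pos (habs k i hi j hj hr ⟨x, hx, hxj⟩)]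
            simp [hxj]
          · simp [hxj]
        · simp [hr]
      · simp [hx]
    have h1 : I k ≤ P * ∑ i ∈ F, a i * α i ^ (p - 1) * ν (E k i) := by
      refine (lintegral_mono hpt).trans ?_
      rw [lintegral_const_mul' _ _ hP', lintegral_finsetSum']
      · gcongr with i hi
        rw [lintegral_indicator_const (hEm k i hi)]
      · intro i hi
        exact (measurable_const.indicator (hEm k i hi)).aemeasurable
    have h2 : ∑ i ∈ F, α i ^ p * ν (R i) ≤ I (k + 1) := by
      calc ∑ i ∈ F, α i ^ p * ν (R i)
          = ∑ i ∈ F, ∫⁻ x in R i, α i ^ p ∂ν := by simp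
        _ ≤ ∑ i ∈ F, ∫⁻ x in R i, (∑ i ∈ F, (E (k + 1) i).indicator (fun _ => a i) x) ^ p ∂ν := by
          refine Finset.sum_le_sum fun i hi => setLIntegral_mono' (hRm i hi) fun x hx => ?_
          gcongr
          rw [hα]
          simp only [Finset.sum_filter]
          refine Finset.sum_le_sum fun j hj => ?_
          split_ifs with h
          · rw [indicator_of_mem (h (hRE k i hi hx))]
          · exact zero_le
        _ = ∫⁻ x in ⋃ i ∈ F, R i,
              (∑ i ∈ F, (E (k + 1) i).indicator (fun _ => a i) x) ^ p ∂ν := by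
          rw [lintegral_biUnion_finset hR hRm]
        _ ≤ _ := setLIntegral_le_lintegral _ _
    calc I k ≤ P * ∑ i ∈ F, a i * α i ^ (p - 1) * ν (E k i) := h1
      _ ≤ P * ∑ i ∈ F, (M ^ (p - 1) * a i ^ p + M⁻¹ * α i ^ p) * (K * A ^ k * ν (R i)) := by
        gcongr with i hi
        · exact ENNReal.mul_rpow_sub_one_le hp _ _ hM hM'
        · exact hν k i hi
      _ = P * K * A ^ k * (M ^ (p - 1) * J + M⁻¹ * ∑ i ∈ F, α i ^ p * ν (R i)) := by
        rw [hJ]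
        simp only [Finset.mul_sum, ← Finset.sum_add_distrib]
        refine Finset.sum_congr rfl fun i _ => ?_
        ring
      _ ≤ _ := by gcongr
  set c := P * K * (2 * P * K * B) ^ (p - 1) with hc
  have hstep' : ∀ k, I k * (B ^ k)⁻¹ ≤ c * J + 2⁻¹ * (I (k + 1) * (B ^ (k + 1))⁻¹) := by
    intro k
    have hAk : A ^ k ≠ 0 := pow_ne_zero _ hA0
    have hAk' : A ^ k ≠ ⊤ := ENNReal.pow_ne_top hA'
    have hBk : B ^ k ≠ 0 := pow_ne_zero _ hB0
    have hBk' : B ^ k ≠ ⊤ := ENNReal.pow_ne_top hB'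
    have hX : 2 * P * K * B ≠ 0 := by simp [hofp, hK, hB0]
    have hX' : 2 * P * K * B ≠ ⊤ := by finiteness
    have hY : P * K * A ^ k ≠ 0 := by simp [hofp, hK, hA0]
    have hY' : P * K * A ^ k ≠ ⊤ := by finiteness
    have h := hstep k (2 * P * K * B * A ^ k) (mul_ne_zero hX hAk) (ENNReal.mul_ne_top hX' hAk')
    have hpow : A ^ k * (A ^ k) ^ (p - 1) = B ^ k := by
      rw [hB, ← ENNReal.rpow_natCast, ← ENNReal.rpow_natCast, ← ENNReal.rpow_mul,
        ← ENNReal.rpow_mul, ← ENNReal.rpow_add _ _ hA0 hA']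
      ring_nf
    have e1 : P * K * A ^ k * (2 * P * K * B * A ^ k) ^ (p - 1) = c * B ^ k := by
      rw [ENNReal.mul_rpow_of_nonneg _ _ hq, hc, ← hpow]; ring
    have e2 : P * K * A ^ k * (2 * P * K * B * A ^ k)⁻¹ = 2⁻¹ * B⁻¹ := by
      rw [show 2 * P * K * B * A ^ k = (P * K * A ^ k) * (2 * B) by ring,
        ENNReal.mul_inv (.inl hY) (.inl hY'), ← mul_assoc, ENNReal.mul_inv_cancel hY hY', one_mul,
        ENNReal.mul_inv (.inl (by simp)) (.inl (by simp))]
    calc I k * (B ^ k)⁻¹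
        ≤ (P * K * A ^ k * ((2 * P * K * B * A ^ k) ^ (p - 1) * J
            + (2 * P * K * B * A ^ k)⁻¹ * I (k + 1))) * (B ^ k)⁻¹ := by gcongr
      _ = (P * K * A ^ k * (2 * P * K * B * A ^ k) ^ (p - 1)) * (B ^ k)⁻¹ * J
            + (P * K * A ^ k * (2 * P * K * B * A ^ k)⁻¹) * (B ^ k)⁻¹ * I (k + 1) := by ring
      _ = c * J + 2⁻¹ * (I (k + 1) * (B ^ (k + 1))⁻¹) := by
        rw [e1, e2, mul_assoc c, ENNReal.mul_inv_cancel hBk hBk', mul_one, pow_succ,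
          ENNReal.mul_inv (.inl hBk) (.inl hBk')]
        ring
  set S := ⨆ k, I k * (B ^ k)⁻¹ with hS
  have hSfin : S ≠ ⊤ := by
    have hb : S ≤ (∑ i ∈ F, a i) ^ p * ν univ := by
      refine iSup_le fun k => ?_
      have hb1 : (B ^ k)⁻¹ ≤ 1 := ENNReal.inv_le_one.2 (one_le_pow₀ hB1)
      refine (mul_le_of_le_one_right (zero_le) hb1).trans ?_
      rw [← lintegral_const]
      refine lintegral_mono fun x => ?_
      dsimp only
      gcongr with i hi
      exact indicator_le_self' (fun _ _ => zero_le) _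
    refine ne_top_of_le_ne_top (ENNReal.mul_ne_top ?_ (measure_ne_top _ _)) hb
    exact ENNReal.rpow_ne_top_of_nonneg hp0.le (ENNReal.sum_ne_top.2 ha)
  have hSle : S ≤ c * J + 2⁻¹ * S := by
    refine iSup_le fun k => (hstep' k).trans ?_
    gcongr
    exact le_iSup (fun k => I k * (B ^ k)⁻¹) (k + 1)
  have hfin : S ≤ 2 * (c * J) := by
    have h2 : 2⁻¹ * S + 2⁻¹ * S = S := by
      rw [← add_mul, ENNReal.inv_two_add_inv_two, one_mul]
    have hne : 2⁻¹ * S ≠ ⊤ := ENNReal.mul_ne_top (by simp) hSfin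
    have h3 : 2⁻¹ * S ≤ c * J := by
      exact (ENNReal.add_le_add_iff_right hne).1 (h2.trans_le hSle)
    calc S = 2 * (2⁻¹ * S) := by
          rw [← mul_assoc, ENNReal.mul_inv_cancel (by simp) (by simp), one_mul]
      _ ≤ _ := by gcongr
  calc I 0 = I 0 * (B ^ 0)⁻¹ := by simp
    _ ≤ S := le_iSup (fun k => I k * (B ^ k)⁻¹) 0
    _ ≤ 2 * (c * J) := hfin
    _ = _ := (mul_assoc _ _ _).symm
section Geometry

variable {n : ℕ}

theorem CubeC_subset_CubeC {x z : Rn n} {r s d : ℝ} (hd : ∀ i, |x i - z i| ≤ d) (h : d + r ≤ s) :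
    CubeC x r ⊆ CubeC z s := by
  intro y hy i
  have h1 := abs_le.1 (hd i)
  have h2 := hy i
  constructor <;> linarith

theorem CubeC_subset_CubeC_of_le {x : Rn n} {r s : ℝ} (h : r ≤ s) : CubeC x r ⊆ CubeC x s :=
  CubeC_subset_CubeC (d := 0) (by simp) (by linarith)

theorem mem_CubeC_self {x : Rn n} {r : ℝ} (h : 0 < r) : x ∈ CubeC x r := fun i => by
  constructor <;> linarith

theorem abs_sub_le_of_mem_CubeC {x y : Rn n} {r : ℝ} (h : y ∈ CubeC x r) (i : Fin n) :
    |y i - x i| ≤ r := by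
  have := h i
  rw [abs_le]; constructor <;> linarith

theorem abs_center_sub_le {x z : Rn n} {r s : ℝ} (h : (CubeC x r ∩ CubeC z s).Nonempty)
    (i : Fin n) : |x i - z i| ≤ r + s := by
  obtain ⟨y, hy, hy'⟩ := h
  have h1 := hy i
  have h2 := hy' i
  rw [abs_le]; constructor <;> linarith

theorem CubeC_subset_CubeC_three_mul {x z : Rn n} {r s : ℝ} (hrs : r ≤ s)
    (h : (CubeC x r ∩ CubeC z s).Nonempty) : CubeC x r ⊆ CubeC z (3 * s) :=
  CubeC_subset_CubeC (abs_center_sub_le h) (by linarith)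

theorem measurableSet_CubeC (x : Rn n) (r : ℝ) : MeasurableSet (CubeC x r) := by
  have : CubeC x r = ⋂ i, (fun y : Rn n => y i) ⁻¹' Ico (x i - r) (x i + r) := by
    ext y; simp [CubeC]
  rw [this]
  exact .iInter fun i => measurableSet_Ico.preimage (by fun_prop)

theorem convex_CubeC (x : Rn n) (r : ℝ) : Convex ℝ (CubeC x r) := by
  intro y hy z hz a b ha hb hab i
  have := convex_Ico (𝕜 := ℝ) (x i - r) (x i + r) (hy i) (hz i) ha hb hab
  simpa using this

theorem abs_sub_le_of_mem_closure_CubeC {x y : Rn n} {r : ℝ} (h : y ∈ closure (CubeC x r))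
    (i : Fin n) : |y i - x i| ≤ r := by
  have hc : IsClosed {y : Rn n | |y i - x i| ≤ r} :=
    isClosed_le (by fun_prop) continuous_const
  exact closure_minimal (fun y hy => abs_sub_le_of_mem_CubeC hy i) hc h

theorem ball_subset_CubeC (x : Rn n) (r : ℝ) : Metric.ball x r ⊆ CubeC x r := by
  intro y hy i
  have h1 : |y i - x i| ≤ dist y x := by
    rw [dist_eq_norm]
    simpa using PiLp.norm_apply_le (y - x) i
  have h2 := abs_le.1 (h1.trans (Metric.mem_ball.1 hy).le)
  have h3 := abs_lt.1 (h1.trans_lt (Metric.mem_ball.1 hy))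
  constructor <;> linarith

theorem dist_le_of_mem_CubeC {x y z : Rn n} {r : ℝ} (hy : y ∈ CubeC x r) (hz : z ∈ CubeC x r) :
    dist y z ≤ n * (2 * r) := by
  rw [EuclideanSpace.dist_eq]
  have hr : ∀ i, |y i - z i| ≤ 2 * r := fun i => by
    have h1 := hy i
    have h2 := hz i
    rw [abs_le]; constructor <;> linarith
  calc √(∑ i, dist (y i) (z i) ^ 2) ≤ ∑ i, dist (y i) (z i) := by
        refine Real.sqrt_le_iff.2 ⟨Finset.sum_nonneg fun _ _ => dist_nonneg, ?_⟩
        exact Finset.sum_sq_le_sq_sum_of_nonneg fun _ _ => dist_nonneg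
    _ ≤ ∑ _i : Fin n, 2 * r := Finset.sum_le_sum fun i _ => by
        rw [Real.dist_eq]; exact hr i
    _ = n * (2 * r) := by simp

theorem setDist_le_dist {A B : Set (Rn n)} {x y : Rn n} (hx : x ∈ A) (hy : y ∈ B) :
    setDist A B ≤ dist x y :=
  csInf_le ⟨0, by rintro d ⟨a, -, b, -, rfl⟩; exact dist_nonneg⟩ ⟨x, hx, y, hy, rfl⟩

theorem exists_dist_lt_of_setDist_lt {A B : Set (Rn n)} {c : ℝ} (hA : A.Nonempty)
    (hB : B.Nonempty) (h : setDist A B < c) : ∃ x ∈ A, ∃ y ∈ B, dist x y < c := by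
  obtain ⟨a, ha⟩ := hA
  obtain ⟨b, hb⟩ := hB
  obtain ⟨d, ⟨x, hx, y, hy, rfl⟩, hd⟩ :=
    exists_lt_of_csInf_lt (s := {d : ℝ | ∃ x ∈ A, ∃ y ∈ B, d = dist x y}) ⟨_, a, ha, b, hb, rfl⟩ h
  exact ⟨x, hx, y, hy, hd⟩

end Geometry

namespace WhitneyDecomp

variable {n : ℕ} {Ω : Set (Rn n)} {Cdim : ℝ} (W : WhitneyDecomp n Ω Cdim) {P Q : Set (Rn n)}

theorem subset_Qstar (hQ : Q ∈ W.cubes) : Q ⊆ Qstar W Q := by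
  intro y hy
  rw [W.eq_cube Q hQ] at hy
  exact CubeC_subset_CubeC_of_le (by linarith [W.radius_pos Q hQ]) hy

theorem center_mem (hQ : Q ∈ W.cubes) : W.center Q ∈ Q := by
  have := mem_CubeC_self (x := W.center Q) (W.radius_pos Q hQ)
  rwa [← W.eq_cube Q hQ] at this

theorem subset_domain (hQ : Q ∈ W.cubes) : Q ⊆ Ω := by
  rw [← W.union_eq]; exact subset_sUnion_of_mem hQ

theorem measurableSet (hQ : Q ∈ W.cubes) : MeasurableSet Q := by
  rw [W.eq_cube Q hQ]; exact measurableSet_CubeC _ _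

theorem measurableSet_Qstar (Q : Set (Rn n)) : MeasurableSet (Qstar W Q) :=
  measurableSet_CubeC _ _

theorem Cdim_nonneg {n : ℕ} {Ω : Set (Rn n)} {Cdim : ℝ} (W : WhitneyDecomp n Ω Cdim) : 0 ≤ Cdim :=
  (Nat.cast_nonneg _).trans (W.overlap_le 0)

theorem setDist_pos (hQ : Q ∈ W.cubes) : 0 < setDist (Qstar W Q) (frontier Ω) := by
  by_contra! h
  have h1 := W.dist_lower Q hQ
  have h2 := W.radius_pos Q hQ
  have h3 := mul_nonpos_of_nonneg_of_nonpos W.Cdim_nonneg h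
  simp only [Qstar] at h3
  linarith

theorem Qstar_subset (hΩ : IsOpen Ω) (hQ : Q ∈ W.cubes) : Qstar W Q ⊆ Ω := by
  refine (convex_CubeC _ _).isPreconnected.subset_of_closure_inter_subset hΩ
    ⟨_, W.subset_Qstar hQ (W.center_mem hQ), W.subset_domain hQ (W.center_mem hQ)⟩ ?_
  rintro z ⟨hz, hzQ⟩
  by_contra hzΩ
  have := setDist_le_dist hzQ (hΩ.frontier_eq ▸ ⟨hz, hzΩ⟩ : z ∈ frontier Ω)
  rw [dist_self] at this
  exact absurd (W.setDist_pos hQ) (not_lt.2 this)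

theorem closure_subset_Qstar (hQ : Q ∈ W.cubes) : closure Q ⊆ Qstar W Q := by
  intro y hy i
  rw [W.eq_cube Q hQ] at hy
  have h1 := abs_le.1 (abs_sub_le_of_mem_closure_CubeC hy i)
  have := W.radius_pos Q hQ
  constructor <;> linarith

theorem frontier_nonempty (hQ : Q ∈ W.cubes) : (frontier Ω).Nonempty := by
  rw [nonempty_iff_ne_empty]
  intro h
  have := W.setDist_pos hQ
  simp [h, setDist] at this

/-- Whitney cubes with intersecting dilates have comparable radii. -/
theorem radius_le (hP : P ∈ W.cubes) (hQ : Q ∈ W.cubes)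
    (h : (Qstar W P ∩ Qstar W Q).Nonempty) :
    W.radius P ≤ (1 + Cdim * (n + Cdim + 1)) * W.radius Q := by
  obtain ⟨y, hyP, hyQ⟩ := h
  have hr := W.radius_pos Q hQ
  have hC := W.Cdim_nonneg
  have h1 : setDist (Qstar W Q) (frontier Ω) < (Cdim + 1) * (9 / 4 * W.radius Q) :=
    (W.dist_upper Q hQ).trans_lt (by linarith)
  obtain ⟨q, hq, f, hf, hqf⟩ := exists_dist_lt_of_setDist_lt ⟨y, hyQ⟩ (W.frontier_nonempty hQ) h1
  have h2 : setDist (Qstar W P) (frontier Ω) ≤ (n + Cdim + 1) * (9 / 4 * W.radius Q) := by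
    refine (setDist_le_dist hyP hf).trans ((dist_triangle y q f).trans ?_)
    have := dist_le_of_mem_CubeC hyQ hq
    linarith
  have h3 := (W.dist_lower P hP).trans (mul_le_mul_of_nonneg_left h2 hC)
  linarith

end WhitneyDecomp

/-- A function on the members of a finite closed cover of a preconnected set which varies by at
most `δ` between members meeting inside the set varies by at most `δ` times the number of members. -/
theorem IsPreconnected.edist_le_card_mul {X ι Y : Type*} [TopologicalSpace X] [Fintype ι]
    [PseudoEMetricSpace Y] {S : Set X} (hS : IsPreconnected S) (T : ι → Set X)
    (hT : ∀ i, IsClosed (T i)) (hST : ∀ i, (S ∩ T i).Nonempty) (hcover : S ⊆ ⋃ i, T i)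
    (f : ι → Y) (δ : ℝ≥0∞)
    (hf : ∀ i j, (S ∩ (T i ∩ T j)).Nonempty → edist (f i) (f j) ≤ δ) (i j : ι) :
    edist (f i) (f j) ≤ Fintype.card ι * δ := by
  classical
  let G : SimpleGraph ι := SimpleGraph.fromRel fun i j => (S ∩ (T i ∩ T j)).Nonempty
  have hadj : ∀ {a b}, G.Adj a b → edist (f a) (f b) ≤ δ := by
    rintro a b ⟨-, h | h⟩
    · exact hf a b h
    · rw [edist_comm]; exact hf b a h
  have hreach : G.Reachable i j := by
    by_contra hij
    obtain ⟨x, hxS, hx, hx'⟩ := isPreconnected_closed_iff.1 hS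
      (⋃ a ∈ {a | G.Reachable i a}, T a) (⋃ a ∈ {a | ¬ G.Reachable i a}, T a)
      ((toFinite _).isClosed_biUnion fun a _ => hT a)
      ((toFinite _).isClosed_biUnion fun a _ => hT a)
      (by
        intro x hx
        obtain ⟨a, ha⟩ := mem_iUnion.1 (hcover hx)
        by_cases h : G.Reachable i a
        · exact .inl (mem_biUnion h ha)
        · exact .inr (mem_biUnion (show a ∈ {a | ¬ G.Reachable i a} from h) ha))
      ((hST i).mono (inter_subset_inter_right _
        (subset_biUnion_of_mem (u := T) (show i ∈ {a | G.Reachable i a} from .rfl))))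
      ((hST j).mono (inter_subset_inter_right _
        (subset_biUnion_of_mem (u := T) (show j ∈ {a | ¬ G.Reachable i a} from hij))))
    simp only [mem_iUnion, mem_ofPred_eq, exists_prop] at hx hx'
    obtain ⟨a, ha, hxa⟩ := hx
    obtain ⟨b, hb, hxb⟩ := hx'
    refine hb (ha.trans (SimpleGraph.Adj.reachable ?_))
    rw [SimpleGraph.fromRel_adj]
    exact ⟨fun h => hb (h ▸ ha), .inl ⟨x, hxS, hxa, hxb⟩⟩
  obtain ⟨q, hq⟩ := hreach.exists_isPath
  have hwalk : ∀ {a b : ι} (q : G.Walk a b), edist (f a) (f b) ≤ q.length * δ := by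
    intro a b q
    induction q with
    | nil => simp
    | cons h q ih =>
      refine (edist_triangle _ _ _).trans ((add_le_add (hadj h) ih).trans ?_)
      rw [SimpleGraph.Walk.length_cons]
      push_cast
      rw [add_mul, one_mul, add_comm]
  refine (hwalk q).trans ?_
  gcongr
  exact hq.length_lt.le

theorem List.edist_add_le_two_mul_sum {α Y : Type*} [PseudoEMetricSpace Y] {r : α → α → Prop}
    {s : Set α} (f : α → Y) (g : α → ℝ≥0∞)
    (hr : ∀ a ∈ s, ∀ b ∈ s, r a b → edist (f a) (f b) ≤ g a + g b) :
    ∀ (L : List α) (x y : α), (∀ a ∈ L, a ∈ s) → L.head? = some x → L.getLast? = some y →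
      L.IsChain r → edist (f x) (f y) + g x ≤ 2 * (L.map g).sum
  | [], _, _, _, hx, _, _ => by simp at hx
  | [a], x, y, _, hx, hy, _ => by
    obtain rfl : a = x := by simpa using hx
    obtain rfl : a = y := by simpa using hy
    simp [two_mul]
  | a :: b :: l, x, y, hs, hx, hy, hc => by
    obtain rfl : a = x := by simpa using hx
    rw [List.isChain_cons_cons] at hc
    have ih := List.edist_add_le_two_mul_sum f g hr (b :: l) b y
      (fun c hc => hs c (List.mem_cons_of_mem _ hc)) rfl (by simpa using hy) hc.2
    have h1 := hr a (hs a (by simp)) b (hs b (by simp)) hc.1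
    rw [List.map_cons, List.sum_cons, mul_add]
    calc edist (f a) (f y) + g a ≤ (g a + g b + edist (f b) (f y)) + g a := by
          gcongr
          exact (edist_triangle _ _ _).trans (by gcongr)
      _ = 2 * g a + (edist (f b) (f y) + g b) := by ring
      _ ≤ _ := by gcongr

section Doubling

variable {n : ℕ} {Ω : Set (Rn n)} {ν : Measure (Rn n)} {Δ : ℝ≥0∞}

theorem measure_CubeC_two_pow_mul_le
    (hd : ∀ x ∈ Ω, ∀ r : ℝ, 0 < r → ν (CubeC x (2 * r)) ≤ Δ * ν (CubeC x r)) {x : Rn n}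
    (hx : x ∈ Ω) {r : ℝ} (hr : 0 < r) (m : ℕ) :
    ν (CubeC x (2 ^ m * r)) ≤ Δ ^ m * ν (CubeC x r) := by
  induction m with
  | zero => simp
  | succ m ih =>
    rw [pow_succ', mul_assoc, pow_succ', mul_assoc]
    exact (hd x hx _ (by positivity)).trans (by gcongr)

theorem measure_CubeC_le_of_abs_sub_le
    (hd : ∀ x ∈ Ω, ∀ r : ℝ, 0 < r → ν (CubeC x (2 * r)) ≤ Δ * ν (CubeC x r)) {x z : Rn n}
    (hz : z ∈ Ω) {r s d : ℝ} (hr : 0 < r) {m : ℕ} (hxz : ∀ i, |x i - z i| ≤ d)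
    (h : d + s ≤ 2 ^ m * r) :
    ν (CubeC x s) ≤ Δ ^ m * ν (CubeC z r) :=
  (measure_mono (CubeC_subset_CubeC hxz h)).trans (measure_CubeC_two_pow_mul_le hd hz hr m)

end Doubling

namespace WhitneyDecomp

variable {n : ℕ} {Ω : Set (Rn n)} {Cdim : ℝ} (W : WhitneyDecomp n Ω Cdim) {P Q R : Set (Rn n)}
  {ν : Measure (Rn n)} {Δ : ℝ≥0∞}

/-- The Whitney cubes whose dilates meet the dilate of `P`. -/
def near (P : Set (Rn n)) : Set (Set (Rn n)) :=
  {R | R ∈ W.cubes ∧ (Qstar W P ∩ Qstar W R).Nonempty}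

theorem mem_near_comm (hP : P ∈ W.cubes) (h : R ∈ W.near P) : P ∈ W.near R :=
  ⟨hP, by rw [inter_comm]; exact h.2⟩

theorem measure_eq (hP : P ∈ W.cubes) : ν P = ν (CubeC (W.center P) (W.radius P)) :=
  congrArg ν (W.eq_cube P hP)

theorem measure_le_of_mem_near
    (hd : ∀ x ∈ Ω, ∀ r : ℝ, 0 < r → ν (CubeC x (2 * r)) ≤ Δ * ν (CubeC x r)) {m : ℕ}
    (hm : 4 * (1 + (1 + Cdim * (n + Cdim + 1))) ≤ 2 ^ m) (hP : P ∈ W.cubes) (hR : R ∈ W.near P) :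
    ν P ≤ Δ ^ m * ν R := by
  rw [W.measure_eq hP, W.measure_eq hR.1]
  have hr := W.radius_le hP hR.1 hR.2
  have hr0 := W.radius_pos R hR.1
  have hrP := W.radius_pos P hP
  have hm' := mul_le_mul_of_nonneg_right hm hr0.le
  refine measure_CubeC_le_of_abs_sub_le hd (W.subset_domain hR.1 (W.center_mem hR.1)) hr0
    (abs_center_sub_le hR.2) ?_
  linarith

theorem card_le_of_subset_near
    (hd : ∀ x ∈ Ω, ∀ r : ℝ, 0 < r → ν (CubeC x (2 * r)) ≤ Δ * ν (CubeC x r)) {m : ℕ}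
    (hm : 4 * (1 + (1 + Cdim * (n + Cdim + 1))) ≤ 2 ^ m) (hP : P ∈ W.cubes) (h0 : ν P ≠ 0)
    (htop : ν P ≠ ⊤) (F : Finset (Set (Rn n))) (hF : (F : Set (Set (Rn n))) ⊆ W.near P) :
    (F.card : ℝ≥0∞) ≤ Δ ^ m * Δ ^ m := by
  have hr0 := W.radius_pos P hP
  have hm' := mul_le_mul_of_nonneg_right hm hr0.le
  have hsub : ⋃ R ∈ F, R ⊆ CubeC (W.center P) (2 ^ m * W.radius P) := by
    refine iUnion₂_subset fun R hR => ?_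
    have hRn := hF hR
    have hr := W.radius_le hRn.1 hP (by rw [inter_comm]; exact hRn.2)
    have hrR := W.radius_pos R hRn.1
    nth_rewrite 1 [W.eq_cube R hRn.1]
    refine CubeC_subset_CubeC (abs_center_sub_le (by rw [inter_comm]; exact hRn.2)) ?_
    linarith
  have hsum : ∑ R ∈ F, ν R ≤ Δ ^ m * ν P := by
    rw [← measure_biUnion_finset (f := fun R => R)]
    · rw [W.measure_eq hP]
      exact (measure_mono hsub).trans
        (measure_CubeC_two_pow_mul_le hd (W.subset_domain hP (W.center_mem hP)) hr0 m)
    · exact W.pairwise_disjoint.subset fun R hR => (hF hR).1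
    · exact fun R hR => W.measurableSet (hF hR).1
  refine (ENNReal.mul_le_mul_iff_left h0 htop).1 ?_
  calc (F.card : ℝ≥0∞) * ν P = ∑ _R ∈ F, ν P := by simp
    _ ≤ ∑ R ∈ F, Δ ^ m * ν R :=
      Finset.sum_le_sum fun R hR => W.measure_le_of_mem_near hd hm hP (hF hR)
    _ = Δ ^ m * ∑ R ∈ F, ν R := by rw [Finset.mul_sum]
    _ ≤ Δ ^ m * (Δ ^ m * ν P) := by gcongr
    _ = _ := by ring

theorem finite_near
    (hd : ∀ x ∈ Ω, ∀ r : ℝ, 0 < r → ν (CubeC x (2 * r)) ≤ Δ * ν (CubeC x r)) (hΔ : Δ ≠ ⊤) {m : ℕ}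
    (hm : 4 * (1 + (1 + Cdim * (n + Cdim + 1))) ≤ 2 ^ m) (hP : P ∈ W.cubes) (h0 : ν P ≠ 0)
    (htop : ν P ≠ ⊤) : (W.near P).Finite := by
  by_contra hinf
  have hM : Δ ^ m * Δ ^ m ≠ ⊤ := by finiteness
  obtain ⟨k, hk⟩ := ENNReal.exists_nat_gt hM
  obtain ⟨F, hF, hFk⟩ := Set.Infinite.exists_subset_card_eq hinf k
  have := W.card_le_of_subset_near hd hm hP h0 htop F hF
  rw [hFk] at this
  exact absurd hk (not_lt.2 this)

/-- The local oscillation of `u` around the constant `c Q` on the dilated cube. -/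
def osc (ν : Measure (Rn n)) (p : ℝ) (u : Rn n → ℝ) (c : Set (Rn n) → ℝ) (Q : Set (Rn n)) :
    ℝ≥0∞ :=
  ∫⁻ x in Qstar W Q, edist (u x) (c Q) ^ p ∂ν

theorem edist_rpow_mul_measure_le (hΩ : IsOpen Ω)
    (hd : ∀ x ∈ Ω, ∀ r : ℝ, 0 < r → ν (CubeC x (2 * r)) ≤ Δ * ν (CubeC x r)) {m : ℕ}
    (hm : 17 * (1 + Cdim * (n + Cdim + 1)) ≤ 2 ^ m) {p : ℝ} (hp : 1 ≤ p) {u : Rn n → ℝ}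
    (hu : AEMeasurable u ν) (c : Set (Rn n) → ℝ) (hP : P ∈ W.cubes) (hQ : Q ∈ W.near P)
    (hR : R ∈ W.near P) (hQR : (Qstar W P ∩ (closure Q ∩ closure R)).Nonempty) :
    edist (c Q) (c R) ^ p * ν P ≤
      Δ ^ m * (2 ^ (p - 1) * (W.osc ν p u c Q + W.osc ν p u c R)) := by
  have hp0 : 0 ≤ p := by linarith
  obtain ⟨z, hzP, hzQ, hzR⟩ := hQR
  set ρ := min (W.radius Q) (W.radius R) with hρ
  have hρQ : ρ ≤ W.radius Q := min_le_left _ _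
  have hρR : ρ ≤ W.radius R := min_le_right _ _
  have hρ0 : 0 < ρ := lt_min (W.radius_pos Q hQ.1) (W.radius_pos R hR.1)
  have hPρ : W.radius P ≤ (1 + Cdim * (n + Cdim + 1)) * ρ := by
    rcases min_choice (W.radius Q) (W.radius R) with h | h
    · rw [hρ, h]; exact W.radius_le hP hQ.1 hQ.2
    · rw [hρ, h]; exact W.radius_le hP hR.1 hR.2
  have hsub : ∀ S ∈ W.cubes, ρ ≤ W.radius S → z ∈ closure S → CubeC z (ρ / 8) ⊆ Qstar W S := by
    intro S hS hρS hzS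
    rw [W.eq_cube S hS] at hzS
    exact CubeC_subset_CubeC (abs_sub_le_of_mem_closure_CubeC hzS) (by linarith)
  have hPz : ν P ≤ Δ ^ m * ν (CubeC z (ρ / 8)) := by
    rw [W.measure_eq hP]
    refine measure_CubeC_le_of_abs_sub_le hd (W.Qstar_subset hΩ hP hzP) (by positivity)
      (d := 9 / 8 * W.radius P)
      (fun i => by rw [abs_sub_comm]; exact abs_sub_le_of_mem_CubeC hzP i) ?_
    have := mul_le_mul_of_nonneg_right hm hρ0.le
    linarith
  have hint : edist (c Q) (c R) ^ p * ν (CubeC z (ρ / 8)) ≤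
      2 ^ (p - 1) * (W.osc ν p u c Q + W.osc ν p u c R) := by
    have hmeas : AEMeasurable (fun x => edist (u x) (c Q) ^ p) (ν.restrict (CubeC z (ρ / 8))) :=
      ((hu.restrict.edist aemeasurable_const).pow_const p)
    calc edist (c Q) (c R) ^ p * ν (CubeC z (ρ / 8))
        = ∫⁻ _x in CubeC z (ρ / 8), edist (c Q) (c R) ^ p ∂ν := by simp
      _ ≤ ∫⁻ x in CubeC z (ρ / 8), 2 ^ (p - 1) * (edist (u x) (c Q) ^ p + edist (u x) (c R) ^ p)
            ∂ν := by
        refine lintegral_mono fun x => ?_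
        refine le_trans ?_ (ENNReal.rpow_add_le_mul_rpow_add_rpow _ _ hp)
        gcongr
        exact edist_triangle_left _ _ _
      _ = 2 ^ (p - 1) * (∫⁻ x in CubeC z (ρ / 8), edist (u x) (c Q) ^ p ∂ν
            + ∫⁻ x in CubeC z (ρ / 8), edist (u x) (c R) ^ p ∂ν) := by
        rw [lintegral_const_mul' _ _ (by finiteness), lintegral_add_left' hmeas]
      _ ≤ _ := by
        gcongr
        · exact lintegral_mono_set (hsub Q hQ.1 hρQ hzQ)
        · exact lintegral_mono_set (hsub R hR.1 hρR hzR)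
  calc edist (c Q) (c R) ^ p * ν P
      ≤ edist (c Q) (c R) ^ p * (Δ ^ m * ν (CubeC z (ρ / 8))) := by gcongr
    _ = Δ ^ m * (edist (c Q) (c R) ^ p * ν (CubeC z (ρ / 8))) := by ring
    _ ≤ _ := by gcongr

/-- The total oscillation over the neighbours of a cube. -/
def nearOsc (ν : Measure (Rn n)) (p : ℝ) (u : Rn n → ℝ) (c : Set (Rn n) → ℝ) (P : Set (Rn n)) :
    ℝ≥0∞ :=
  ∑' R : W.cubes, (W.near P).indicator (W.osc ν p u c) R

theorem osc_le_nearOsc (p : ℝ) (u : Rn n → ℝ) (c : Set (Rn n) → ℝ) (hR : R ∈ W.near P) :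
    W.osc ν p u c R ≤ W.nearOsc ν p u c P := by
  have := ENNReal.le_tsum (f := fun R : W.cubes => (W.near P).indicator (W.osc ν p u c) R)
    ⟨R, hR.1⟩
  rwa [indicator_of_mem (show R ∈ W.near P from hR)] at this

theorem nearOsc_le_tsum (p : ℝ) (u : Rn n → ℝ) (c : Set (Rn n) → ℝ) :
    W.nearOsc ν p u c P ≤ ∑' R : W.cubes, W.osc ν p u c R :=
  ENNReal.tsum_le_tsum fun _ => indicator_le_self' (fun _ _ => zero_le) _

theorem tsum_nearOsc_le
    (hd : ∀ x ∈ Ω, ∀ r : ℝ, 0 < r → ν (CubeC x (2 * r)) ≤ Δ * ν (CubeC x r)) {m : ℕ}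
    (hm : 4 * (1 + (1 + Cdim * (n + Cdim + 1))) ≤ 2 ^ m) (h0 : ∀ P ∈ W.cubes, ν P ≠ 0)
    (htop : ∀ P ∈ W.cubes, ν P ≠ ⊤) (p : ℝ) (u : Rn n → ℝ) (c : Set (Rn n) → ℝ) :
    ∑' P : W.cubes, W.nearOsc ν p u c P ≤
      Δ ^ m * Δ ^ m * ∑' R : W.cubes, W.osc ν p u c R := by
  classical
  simp only [nearOsc]
  rw [ENNReal.tsum_comm, ← ENNReal.tsum_mul_left]
  refine ENNReal.tsum_le_tsum fun R => ?_
  rw [ENNReal.tsum_eq_iSup_sum]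
  refine iSup_le fun s => ?_
  simp only [indicator_apply]
  rw [← Finset.sum_filter, Finset.sum_const, nsmul_eq_mul]
  gcongr
  have := W.card_le_of_subset_near hd hm R.2 (h0 R R.2) (htop R R.2)
    ((s.filter fun P : W.cubes => (R : Set (Rn n)) ∈ W.near P.1).map (Function.Embedding.subtype _)) (by
      intro P hP
      simp only [Finset.coe_map, Finset.coe_filter, mem_image, mem_ofPred_eq] at hP
      obtain ⟨P', hP', rfl⟩ := hP
      exact W.mem_near_comm P'.2 hP'.2)
  simpa using this

theorem edist_le_of_inter_nonempty (hΩ : IsOpen Ω)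
    (hd : ∀ x ∈ Ω, ∀ r : ℝ, 0 < r → ν (CubeC x (2 * r)) ≤ Δ * ν (CubeC x r)) (hΔ : Δ ≠ ⊤) {m : ℕ}
    (hm : 17 * (1 + (1 + Cdim * (n + Cdim + 1))) ≤ 2 ^ m) {p : ℝ} (hp : 1 ≤ p) {u : Rn n → ℝ}
    (hu : AEMeasurable u ν) (c : Set (Rn n) → ℝ) (hP : P ∈ W.cubes) (h0 : ν P ≠ 0)
    (htop : ν P ≠ ⊤) (hR : R ∈ W.cubes) (hPR : (Qstar W P ∩ R).Nonempty) :
    edist (c P) (c R) ≤ Δ ^ m * Δ ^ m *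
      (Δ ^ m * 2 ^ p * (W.nearOsc ν p u c P / ν P)) ^ p⁻¹ := by
  classical
  have hp0 : 0 < p := by linarith
  have hC := W.Cdim_nonneg
  have hκ : 0 ≤ Cdim * (n + Cdim + 1) := by positivity
  have hm4 : 4 * (1 + (1 + Cdim * (n + Cdim + 1))) ≤ 2 ^ m := by linarith
  have hm17 : 17 * (1 + Cdim * (n + Cdim + 1)) ≤ 2 ^ m := by linarith
  set V : Set (Set (Rn n)) := {S | S ∈ W.cubes ∧ (Qstar W P ∩ S).Nonempty} with hV
  have hVn : V ⊆ W.near P := fun S hS =>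
    ⟨hS.1, hS.2.mono (inter_subset_inter_right _ (W.subset_Qstar hS.1))⟩
  have hVfin : V.Finite := (W.finite_near hd hΔ hm4 hP h0 htop).subset hVn
  have hPV : P ∈ V := ⟨hP, _, W.subset_Qstar hP (W.center_mem hP), W.center_mem hP⟩
  have hRV : R ∈ V := ⟨hR, hPR⟩
  let _ : Fintype V := hVfin.fintype
  have hedge : ∀ S S' : V, (Qstar W P ∩ (closure S.1 ∩ closure S'.1)).Nonempty →
      edist (c S) (c S') ≤ (Δ ^ m * 2 ^ p * (W.nearOsc ν p u c P / ν P)) ^ p⁻¹ := by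
    intro S S' hSS'
    rw [ENNReal.le_rpow_inv_iff hp0, ← mul_div_assoc,
      ENNReal.le_div_iff_mul_le (.inl h0) (.inl htop)]
    refine (W.edist_rpow_mul_measure_le hΩ hd hm17 hp hu c hP (hVn S.2) (hVn S'.2) hSS').trans ?_
    have h2 : (2 : ℝ≥0∞) ^ p = 2 ^ (p - 1) * 2 := by
      conv_lhs => rw [show p = (p - 1) + 1 by ring]
      rw [ENNReal.rpow_add _ _ (by simp) (by simp), ENNReal.rpow_one]
    rw [h2, mul_assoc, mul_assoc, two_mul]
    gcongr
    · exact W.osc_le_nearOsc p u c (hVn S.2)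
    · exact W.osc_le_nearOsc p u c (hVn S'.2)
  have hmain := (convex_CubeC (W.center P) (9 / 8 * W.radius P)).isPreconnected.edist_le_card_mul
    (fun S : V => closure S.1) (fun _ => isClosed_closure)
    (fun S => S.2.2.mono (inter_subset_inter_right _ subset_closure))
    (by
      intro x hx
      have hxΩ := W.Qstar_subset hΩ hP hx
      rw [← W.union_eq] at hxΩ
      obtain ⟨S, hS, hxS⟩ := hxΩ
      exact mem_iUnion.2 ⟨⟨S, hS, x, hx, hxS⟩, subset_closure hxS⟩)
    (fun S : V => c S) _ hedge ⟨P, hPV⟩ ⟨R, hRV⟩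
  refine hmain.trans ?_
  gcongr
  have := W.card_le_of_subset_near hd hm4 hP h0 htop hVfin.toFinset (by simpa using hVn)
  rwa [← Set.toFinset_card V, ← Set.Finite.toFinset_eq_toFinset hVfin]

end WhitneyDecomp

/-- The constant in the local-to-global estimate, in terms of the exponent, the doubling constant
and the number of doublings needed to compare neighbouring cubes. -/
def localToGlobalConst (p : ℝ) (Δ : ℝ≥0∞) (m : ℕ) : ℝ≥0∞ :=
  2 ^ (p - 1) * (1 + 2 ^ p * (2 * (ENNReal.ofReal p * Δ ^ m *
    (2 * ENNReal.ofReal p * Δ ^ m * (Δ ^ 2) ^ p) ^ (p - 1)) *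
      ((Δ ^ m * Δ ^ m) ^ p * (Δ ^ m * 2 ^ p) * (Δ ^ m * Δ ^ m))))

theorem localToGlobalConst_ne_top {p : ℝ} (hp : 1 ≤ p) {Δ : ℝ≥0∞} (hΔ : Δ ≠ ⊤) (m : ℕ) :
    localToGlobalConst p Δ m ≠ ⊤ := by
  have h0 : 0 ≤ p := by linarith
  have h1 : 0 ≤ p - 1 := by linarith
  unfold localToGlobalConst
  finiteness

theorem localToGlobalConst_ne_zero {p : ℝ} (Δ : ℝ≥0∞) (m : ℕ) :
    localToGlobalConst p Δ m ≠ 0 := by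
  unfold localToGlobalConst
  refine mul_ne_zero ?_ (by simp)
  simp

namespace BomanDecomp

variable {n : ℕ} {Ω : Set (Rn n)} {Cdim cdim N : ℝ} (B : BomanDecomp n Ω Cdim cdim N)
  {ν : Measure (Rn n)} {Δ : ℝ≥0∞}

/-- The bound for the jump of the constants `c` around a Whitney cube. -/
def jump (ν : Measure (Rn n)) (Δ : ℝ≥0∞) (m : ℕ) (p : ℝ) (u : Rn n → ℝ) (c : Set (Rn n) → ℝ)
    (P : Set (Rn n)) : ℝ≥0∞ :=
  Δ ^ m * Δ ^ m * (Δ ^ m * 2 ^ p * (B.nearOsc ν p u c P / ν P)) ^ p⁻¹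

theorem jump_rpow_mul_measure {m : ℕ} {p : ℝ} (hp : 1 ≤ p) (u : Rn n → ℝ)
    (c : Set (Rn n) → ℝ) {P : Set (Rn n)} (h0 : ν P ≠ 0) (htop : ν P ≠ ⊤) :
    B.jump ν Δ m p u c P ^ p * ν P =
      (Δ ^ m * Δ ^ m) ^ p * (Δ ^ m * 2 ^ p) * B.nearOsc ν p u c P := by
  have hp0 : 0 < p := by linarith
  rw [jump, ENNReal.mul_rpow_of_nonneg _ _ hp0.le, ENNReal.rpow_inv_rpow hp0.ne', mul_assoc,
    mul_assoc (Δ ^ m * 2 ^ p), ENNReal.div_mul_cancel h0 htop]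
  ring

theorem edist_central_le (hΩ : IsOpen Ω)
    (hd : ∀ x ∈ Ω, ∀ r : ℝ, 0 < r → ν (CubeC x (2 * r)) ≤ Δ * ν (CubeC x r)) (hΔ : Δ ≠ ⊤) {m : ℕ}
    (hm : 17 * (1 + (1 + Cdim * (n + Cdim + 1))) ≤ 2 ^ m) {p : ℝ} (hp : 1 ≤ p) {u : Rn n → ℝ}
    (hu : AEMeasurable u ν) (c : Set (Rn n) → ℝ) (h0 : ∀ P ∈ B.cubes, ν P ≠ 0)
    (htop : ∀ P ∈ B.cubes, ν P ≠ ⊤) {Q : Set (Rn n)} (hQ : Q ∈ B.cubes) :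
    edist (c B.central) (c Q) ≤ 2 * ((B.chain Q).map (B.jump ν Δ m p u c)).sum := by
  obtain ⟨hmem, -, hhead, hlast, hchain⟩ := B.chain_isChain Q hQ
  refine le_self_add.trans (List.edist_add_le_two_mul_sum c (B.jump ν Δ m p u c)
    (s := B.cubes) ?_ (B.chain Q) B.central Q hmem hhead hlast hchain)
  rintro P hP R hR ⟨z, r, hr, hsub, -⟩
  obtain ⟨hzP, hzR⟩ := hsub (mem_CubeC_self hr)
  have hzΩ := B.Qstar_subset hΩ hP hzP
  rw [← B.union_eq] at hzΩ
  obtain ⟨S, hS, hzS⟩ := hzΩ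
  refine (edist_triangle_right _ _ (c S)).trans (add_le_add ?_ ?_)
  · exact B.edist_le_of_inter_nonempty hΩ hd hΔ hm hp hu c hP (h0 P hP) (htop P hP) hS
      ⟨z, hzP, hzS⟩
  · exact B.edist_le_of_inter_nonempty hΩ hd hΔ hm hp hu c hR (h0 R hR) (htop R hR) hS
      ⟨z, hzR, hzS⟩

theorem sum_edist_central_rpow_mul_le [IsFiniteMeasure ν] (hΩ : IsOpen Ω)
    (hd : ∀ x ∈ Ω, ∀ r : ℝ, 0 < r → ν (CubeC x (2 * r)) ≤ Δ * ν (CubeC x r)) (hΔ1 : 1 ≤ Δ)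
    (hΔ : Δ ≠ ⊤) (hN : 1 ≤ N) {m : ℕ} (hm : 17 * (1 + (1 + Cdim * (n + Cdim + 1))) ≤ 2 ^ m)
    (hmN : N ≤ 2 ^ m) {p : ℝ} (hp : 1 ≤ p) {u : Rn n → ℝ} (hu : AEMeasurable u ν)
    (c : Set (Rn n) → ℝ) (h0 : ∀ P ∈ B.cubes, ν P ≠ 0)
    (hfin : ∑' Q : B.cubes, B.osc ν p u c Q ≠ ⊤) (G : Finset (Set (Rn n)))
    (hG : (G : Set (Set (Rn n))) ⊆ B.cubes) :
    ∑ Q ∈ G, edist (c B.central) (c Q) ^ p * ν Q ≤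
      2 ^ p * (2 * (ENNReal.ofReal p * Δ ^ m *
        (2 * ENNReal.ofReal p * Δ ^ m * (Δ ^ 2) ^ p) ^ (p - 1)) *
          ((Δ ^ m * Δ ^ m) ^ p * (Δ ^ m * 2 ^ p) * (Δ ^ m * Δ ^ m))) *
        ∑' Q : B.cubes, B.osc ν p u c Q := by
  classical
  have hp0 : 0 < p := by linarith
  have hC := B.Cdim_nonneg
  have hκ : 0 ≤ Cdim * (n + Cdim + 1) := by positivity
  have hΔ0 : Δ ≠ 0 := (zero_lt_one.trans_le hΔ1).ne'
  have htop : ∀ P ∈ B.cubes, ν P ≠ ⊤ := fun P _ => measure_ne_top _ _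
  set a := B.jump ν Δ m p u c with ha
  set F : Finset (Set (Rn n)) := G.biUnion fun Q => (B.chain Q).toFinset with hF
  have hFc : ∀ R ∈ F, R ∈ B.cubes := by
    intro R hR
    obtain ⟨Q, hQ, hRQ⟩ := Finset.mem_biUnion.1 hR
    exact (B.chain_isChain Q (hG hQ)).1 R (List.mem_toFinset.1 hRQ)
  set E : ℕ → Set (Rn n) → Set (Rn n) :=
    fun k R => CubeC (B.center R) (3 ^ k * N * B.radius R) with hE
  have haTop : ∀ R ∈ F, a R ≠ ⊤ := by
    intro R hR
    have h1 : B.nearOsc ν p u c R / ν R ≠ ⊤ :=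
      ENNReal.div_ne_top (ne_top_of_le_ne_top hfin (B.nearOsc_le_tsum p u c)) (h0 R (hFc R hR))
    have h2 : 0 ≤ p⁻¹ := by positivity
    rw [ha, jump]
    finiteness
  have key := lintegral_sum_indicator_rpow_le (ν := ν) hp F id E B.radius a (K := Δ ^ m)
    (A := Δ ^ 2) (pow_ne_zero _ hΔ0) (by finiteness) (one_le_pow₀ hΔ1) (by finiteness) haTop
    (fun R hR => B.measurableSet (hFc R hR)) (fun k R _ => measurableSet_CubeC _ _)
    (B.pairwise_disjoint.subset fun R hR => hFc R hR)
    (by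
      intro k R hR
      have hr := B.radius_pos R (hFc R hR)
      have h1 : (1 : ℝ) ≤ 3 ^ k * N := one_le_mul_of_one_le_of_one_le (one_le_pow₀ (by norm_num)) hN
      rw [id, hE]
      nth_rewrite 1 [B.eq_cube R (hFc R hR)]
      exact CubeC_subset_CubeC_of_le (le_mul_of_one_le_left hr.le h1))
    (by
      intro k R _ S _ hRS hne
      have := CubeC_subset_CubeC_three_mul (r := 3 ^ k * N * B.radius R)
        (s := 3 ^ k * N * B.radius S) (by gcongr) hne
      refine this.trans (CubeC_subset_CubeC_of_le (le_of_eq ?_))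
      ring)
    (by
      intro k R hR
      have hr := B.radius_pos R (hFc R hR)
      rw [id, B.measure_eq (hFc R hR), ← pow_mul, ← pow_add]
      refine measure_CubeC_le_of_abs_sub_le hd
        (B.subset_domain (hFc R hR) (B.center_mem (hFc R hR))) hr (d := 0) (by simp) ?_
      rw [zero_add, pow_add, pow_mul, mul_comm (2 ^ m : ℝ)]
      gcongr
      norm_num)
  have hQle : ∀ Q ∈ G, ∀ x ∈ Q, edist (c B.central) (c Q) ≤
      2 * ∑ R ∈ F, (E 0 R).indicator (fun _ => a R) x := by
    intro Q hQ x hx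
    refine (B.edist_central_le hΩ hd hΔ hm hp hu c h0 htop (hG hQ)).trans ?_
    gcongr
    rw [← List.sum_toFinset _ (B.chain_isChain Q (hG hQ)).2.1]
    calc ∑ R ∈ (B.chain Q).toFinset, B.jump ν Δ m p u c R
        = ∑ R ∈ (B.chain Q).toFinset, (E 0 R).indicator (fun _ => a R) x := by
          refine Finset.sum_congr rfl fun R hR => ?_
          have hRQ := List.mem_toFinset.1 hR
          have hRc := (B.chain_isChain Q (hG hQ)).1 R hRQ
          have hxE : x ∈ E 0 R := by
            have := B.shadow_subset R hRc Q (hG hQ) hRQ hx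
            simpa [hE] using this
          rw [indicator_of_mem hxE]
      _ ≤ _ := Finset.sum_le_sum_of_subset fun R hR => Finset.mem_biUnion.2 ⟨Q, hQ, hR⟩
  have hsumF : ∑ R ∈ F, a R ^ p * ν (id R) ≤ (Δ ^ m * Δ ^ m) ^ p * (Δ ^ m * 2 ^ p) *
      (Δ ^ m * Δ ^ m * ∑' Q : B.cubes, B.osc ν p u c Q) := by
    calc ∑ R ∈ F, a R ^ p * ν (id R)
        = ∑ R ∈ F, (Δ ^ m * Δ ^ m) ^ p * (Δ ^ m * 2 ^ p) * B.nearOsc ν p u c R :=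
          Finset.sum_congr rfl fun R hR =>
            B.jump_rpow_mul_measure hp u c (h0 R (hFc R hR)) (htop R (hFc R hR))
      _ = (Δ ^ m * Δ ^ m) ^ p * (Δ ^ m * 2 ^ p) * ∑ R ∈ F, B.nearOsc ν p u c R := by
          rw [Finset.mul_sum]
      _ ≤ (Δ ^ m * Δ ^ m) ^ p * (Δ ^ m * 2 ^ p) * ∑' R : B.cubes, B.nearOsc ν p u c R := by
          gcongr
          rw [← Finset.sum_subtype_of_mem (p := fun R => R ∈ B.cubes) _ hFc]
          exact ENNReal.sum_le_tsum _
      _ ≤ _ := by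
          gcongr
          exact B.tsum_nearOsc_le hd (by linarith) h0 htop p u c
  calc ∑ Q ∈ G, edist (c B.central) (c Q) ^ p * ν Q
      = ∑ Q ∈ G, ∫⁻ _x in Q, edist (c B.central) (c Q) ^ p ∂ν := by simp
    _ ≤ ∑ Q ∈ G, ∫⁻ x in Q, (2 * ∑ R ∈ F, (E 0 R).indicator (fun _ => a R) x) ^ p ∂ν := by
        refine Finset.sum_le_sum fun Q hQ => setLIntegral_mono' (B.measurableSet (hG hQ))
          fun x hx => ?_
        gcongr
        exact hQle Q hQ x hx
    _ = ∫⁻ x in ⋃ Q ∈ G, Q, (2 * ∑ R ∈ F, (E 0 R).indicator (fun _ => a R) x) ^ p ∂ν := by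
        rw [lintegral_biUnion_finset (t := fun Q => Q) (B.pairwise_disjoint.subset hG)
          fun Q hQ => B.measurableSet (hG hQ)]
    _ ≤ ∫⁻ x, (2 * ∑ R ∈ F, (E 0 R).indicator (fun _ => a R) x) ^ p ∂ν :=
        setLIntegral_le_lintegral _ _
    _ = 2 ^ p * ∫⁻ x, (∑ R ∈ F, (E 0 R).indicator (fun _ => a R) x) ^ p ∂ν := by
        simp_rw [ENNReal.mul_rpow_of_nonneg _ _ hp0.le]
        rw [lintegral_const_mul' _ _ (by finiteness)]
    _ ≤ 2 ^ p * (2 * (ENNReal.ofReal p * Δ ^ m *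
          (2 * ENNReal.ofReal p * Δ ^ m * (Δ ^ 2) ^ p) ^ (p - 1)) *
            ((Δ ^ m * Δ ^ m) ^ p * (Δ ^ m * 2 ^ p) *
              (Δ ^ m * Δ ^ m * ∑' Q : B.cubes, B.osc ν p u c Q))) := by
        gcongr
        exact key.trans (by gcongr)
    _ = _ := by ring

/-- The local-to-global estimate for a finite doubling measure and arbitrary constants. -/
theorem setLIntegral_edist_rpow_le [IsFiniteMeasure ν] (hΩ : IsOpen Ω)
    (hd : ∀ x ∈ Ω, ∀ r : ℝ, 0 < r → ν (CubeC x (2 * r)) ≤ Δ * ν (CubeC x r)) (hΔ1 : 1 ≤ Δ)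
    (hΔ : Δ ≠ ⊤) (hN : 1 ≤ N) {m : ℕ} (hm : 17 * (1 + (1 + Cdim * (n + Cdim + 1))) ≤ 2 ^ m)
    (hmN : N ≤ 2 ^ m) {p : ℝ} (hp : 1 ≤ p) {u : Rn n → ℝ} (hu : AEMeasurable u ν)
    (c : Set (Rn n) → ℝ) (h0 : ∀ P ∈ B.cubes, ν P ≠ 0) :
    ∫⁻ x in Ω, edist (u x) (c B.central) ^ p ∂ν ≤
      localToGlobalConst p Δ m * ∑' Q : B.cubes, B.osc ν p u c Q := by
  classical
  have hp0 : 0 < p := by linarith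
  by_cases hfin : ∑' Q : B.cubes, B.osc ν p u c Q = ⊤
  · rw [hfin, ENNReal.mul_top (localToGlobalConst_ne_zero Δ m)]
    exact le_top
  have hcount : Countable B.cubes := B.countable.to_subtype
  have htsum : ∑' Q : B.cubes, edist (c B.central) (c Q) ^ p * ν Q ≤
      2 ^ p * (2 * (ENNReal.ofReal p * Δ ^ m *
        (2 * ENNReal.ofReal p * Δ ^ m * (Δ ^ 2) ^ p) ^ (p - 1)) *
          ((Δ ^ m * Δ ^ m) ^ p * (Δ ^ m * 2 ^ p) * (Δ ^ m * Δ ^ m))) *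
        ∑' Q : B.cubes, B.osc ν p u c Q := by
    rw [ENNReal.tsum_eq_iSup_sum]
    refine iSup_le fun s => ?_
    have := B.sum_edist_central_rpow_mul_le hΩ hd hΔ1 hΔ hN hm hmN hp hu c h0 hfin
      (s.map (Function.Embedding.subtype _)) (by
        intro Q hQ
        obtain ⟨Q', -, rfl⟩ := Finset.mem_map.1 hQ
        exact Q'.2)
    rwa [Finset.sum_map] at this
  have hUnion : Ω = ⋃ Q : B.cubes, (Q : Set (Rn n)) := by
    rw [← sUnion_eq_iUnion, B.union_eq]
  have hsplit : ∀ g : Rn n → ℝ≥0∞,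
      ∫⁻ x in Ω, g x ∂ν = ∑' Q : B.cubes, ∫⁻ x in (Q : Set (Rn n)), g x ∂ν := fun g =>
    (congrArg (fun s => ∫⁻ x in s, g x ∂ν) hUnion).trans
      (lintegral_iUnion (s := fun Q : B.cubes => (Q : Set (Rn n)))
        (fun Q => B.measurableSet Q.2)
        (fun Q R hQR => B.pairwise_disjoint Q.2 R.2 fun h => hQR (Subtype.ext h)) _)
  calc ∫⁻ x in Ω, edist (u x) (c B.central) ^ p ∂ν
      = ∑' Q : B.cubes, ∫⁻ x in (Q : Set (Rn n)), edist (u x) (c B.central) ^ p ∂ν := hsplit _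
    _ ≤ ∑' Q : B.cubes, 2 ^ (p - 1) *
          (B.osc ν p u c Q + edist (c B.central) (c Q) ^ p * ν Q) := by
        refine ENNReal.tsum_le_tsum fun Q => ?_
        calc ∫⁻ x in (Q : Set (Rn n)), edist (u x) (c B.central) ^ p ∂ν
            ≤ ∫⁻ x in (Q : Set (Rn n)),
                2 ^ (p - 1) * (edist (u x) (c Q) ^ p + edist (c B.central) (c Q) ^ p) ∂ν := by
              refine lintegral_mono fun x => ?_
              refine le_trans ?_ (ENNReal.rpow_add_le_mul_rpow_add_rpow _ _ hp)
              gcongr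
              exact edist_triangle_right _ _ _
          _ = 2 ^ (p - 1) * (∫⁻ x in (Q : Set (Rn n)), edist (u x) (c Q) ^ p ∂ν
                + edist (c B.central) (c Q) ^ p * ν Q) := by
              rw [lintegral_const_mul' _ _ (by finiteness), lintegral_add_right _ measurable_const]
              simp
          _ ≤ _ := by
              gcongr
              exact lintegral_mono_set (B.subset_Qstar Q.2)
    _ = 2 ^ (p - 1) * (∑' Q : B.cubes, B.osc ν p u c Q +
          ∑' Q : B.cubes, edist (c B.central) (c Q) ^ p * ν Q) := by
        rw [ENNReal.tsum_mul_left, ENNReal.tsum_add]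
    _ ≤ 2 ^ (p - 1) * (∑' Q : B.cubes, B.osc ν p u c Q +
          2 ^ p * (2 * (ENNReal.ofReal p * Δ ^ m *
            (2 * ENNReal.ofReal p * Δ ^ m * (Δ ^ 2) ^ p) ^ (p - 1)) *
              ((Δ ^ m * Δ ^ m) ^ p * (Δ ^ m * 2 ^ p) * (Δ ^ m * Δ ^ m))) *
            ∑' Q : B.cubes, B.osc ν p u c Q) := by
        gcongr
    _ = _ := by
        rw [localToGlobalConst]
        ring

end BomanDecomp

section Weight

variable {n : ℕ} {Ω : Set (Rn n)} {w : Rn n → ℝ}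

theorem wMeasure_restrict_apply (w : Rn n → ℝ) (hΩ : MeasurableSet Ω) {s : Set (Rn n)}
    (hs : MeasurableSet s) : (wMeasure w).restrict Ω s = wMass w (Ω ∩ s) := by
  rw [Measure.restrict_apply hs, wMeasure, withDensity_apply _ (hs.inter hΩ), inter_comm, wMass]

theorem setLIntegral_mul_ofReal_eq (hw : LocallyIntegrableOn w Ω volume)
    {g : Rn n → ℝ≥0∞} (hg : AEMeasurable g ((wMeasure w).restrict Ω)) {s : Set (Rn n)}
    (hs : MeasurableSet s) (hsΩ : s ⊆ Ω) :
    ∫⁻ x in s, g x * ENNReal.ofReal (w x) = ∫⁻ x in s, g x ∂((wMeasure w).restrict Ω) := by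
  have hwm : AEMeasurable (fun x => ENNReal.ofReal (w x)) (volume.restrict s) :=
    (hw.aestronglyMeasurable.mono_measure (Measure.restrict_mono hsΩ le_rfl)).aemeasurable.ennreal_ofReal
  have hres : ((wMeasure w).restrict Ω).restrict s =
      (volume.restrict s).withDensity fun x => ENNReal.ofReal (w x) := by
    rw [Measure.restrict_restrict hs, inter_eq_self_of_subset_left hsΩ, wMeasure,
      restrict_withDensity hs]
  have hg' : AEMeasurable g ((volume.restrict s).withDensity fun x => ENNReal.ofReal (w x)) := by
    rw [← hres]; exact hg.restrict
  rw [hres, lintegral_withDensity_eq_lintegral_mul₀' hwm hg']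
  refine lintegral_congr fun x => ?_
  rw [Pi.mul_apply, mul_comm]

theorem wMeasure_restrict_ne_zero (hΩ : MeasurableSet Ω) (hw : LocallyIntegrableOn w Ω volume)
    (hpos : ∀ᵐ x ∂(volume : Measure (Rn n)), x ∈ Ω → 0 < w x) {s : Set (Rn n)}
    (hs : MeasurableSet s) (hsΩ : s ⊆ Ω) (hs0 : volume s ≠ 0) :
    (wMeasure w).restrict Ω s ≠ 0 := by
  rw [wMeasure_restrict_apply w hΩ hs, inter_eq_self_of_subset_right hsΩ, wMass]
  have hwm : AEMeasurable (fun x => ENNReal.ofReal (w x)) (volume.restrict s) :=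
    (hw.aestronglyMeasurable.mono_measure (Measure.restrict_mono hsΩ le_rfl)).aemeasurable.ennreal_ofReal
  intro h
  rw [lintegral_eq_zero_iff' hwm] at h
  apply hs0
  rw [← Measure.restrict_eq_zero, ← ae_eq_bot, ← Filter.eventually_false_iff_eq_bot]
  filter_upwards [h, ae_restrict_of_ae hpos, ae_restrict_mem hs] with x hx hx' hxs
  have h1 := hx' (hsΩ hxs)
  simp only [Pi.zero_apply, ENNReal.ofReal_eq_zero] at hx
  linarith

theorem WhitneyDecomp.volume_ne_zero {Cdim : ℝ} (W : WhitneyDecomp n Ω Cdim) {Q : Set (Rn n)}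
    (hQ : Q ∈ W.cubes) : volume Q ≠ 0 := by
  rw [W.measure_eq hQ]
  exact ((Metric.measure_ball_pos volume _ (W.radius_pos Q hQ)).trans_le
    (measure_mono (ball_subset_CubeC _ _))).ne'

theorem WhitneyDecomp.wMeasure_ne_top {Cdim : ℝ} (W : WhitneyDecomp n Ω Cdim) (hΩ : IsOpen Ω)
    (hb : Bornology.IsBounded Ω) (hw : LocallyIntegrableOn w Ω volume) {Q : Set (Rn n)}
    (hQ : Q ∈ W.cubes) : (wMeasure w).restrict Ω Q ≠ ⊤ := by
  rw [wMeasure_restrict_apply w hΩ.measurableSet (W.measurableSet hQ),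
    inter_eq_self_of_subset_right (W.subset_domain hQ), wMass]
  have hint : IntegrableOn w (closure Q) volume :=
    hw.integrableOn_compact_subset ((W.closure_subset_Qstar hQ).trans (W.Qstar_subset hΩ hQ))
      (hb.subset (W.subset_domain hQ)).isCompact_closure
  have := (hint.mono_set subset_closure).lintegral_lt_top
  exact this.ne

theorem isFiniteMeasure_wMeasure_restrict {Cdim : ℝ} (W : WhitneyDecomp n Ω Cdim)
    (hΩ : IsOpen Ω) (hb : Bornology.IsBounded Ω) (hw : LocallyIntegrableOn w Ω volume)
    {Δ : ℝ≥0∞} (hΔ : Δ ≠ ⊤) (hd : ∀ x ∈ Ω, ∀ r : ℝ, 0 < r →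
      (wMeasure w).restrict Ω (CubeC x (2 * r)) ≤ Δ * (wMeasure w).restrict Ω (CubeC x r))
    {Q : Set (Rn n)} (hQ : Q ∈ W.cubes) : IsFiniteMeasure ((wMeasure w).restrict Ω) := by
  have hr := W.radius_pos Q hQ
  obtain ⟨ρ, hρ⟩ := hb.subset_ball (W.center Q)
  obtain ⟨k, hk⟩ := pow_unbounded_of_one_lt (ρ / W.radius Q) (one_lt_two (α := ℝ))
  have hk' : ρ ≤ 2 ^ k * W.radius Q := ((div_lt_iff₀ hr).1 hk).le
  have hsub : Ω ⊆ CubeC (W.center Q) (2 ^ k * W.radius Q) :=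
    hρ.trans ((ball_subset_CubeC _ _).trans (CubeC_subset_CubeC_of_le hk'))
  refine ⟨?_⟩
  calc (wMeasure w).restrict Ω univ = (wMeasure w).restrict Ω Ω := by simp
    _ ≤ (wMeasure w).restrict Ω (CubeC (W.center Q) (2 ^ k * W.radius Q)) := measure_mono hsub
    _ ≤ Δ ^ k * (wMeasure w).restrict Ω (CubeC (W.center Q) (W.radius Q)) :=
      measure_CubeC_two_pow_mul_le hd (W.subset_domain hQ (W.center_mem hQ)) hr k
    _ < ⊤ := by
      rw [← W.measure_eq hQ]
      exact ENNReal.mul_lt_top (by finiteness) (W.wMeasure_ne_top hΩ hb hw hQ).lt_top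

end Weight

/-- local-to-global estimate: let `Ω ⊆ ℝ^n` be a bounded Boman domain
with constant `N`, `w` a doubling weight in `Ω` with constant `D`, `u ∈ L¹_loc(Ω; w dx)`
and `1 ≤ p < ∞`. Then
`∫_Ω |u − u_{w;Q₀*}|^p w dx ≤ C(n, p, D, N) Σ_{Q∈W(Ω)} ∫_{Q*} |u − u_{w;Q*}|^p w dx`,
where `Q₀` is the central cube of the chain decomposition. -/
theorem local_to_global_estimate
    (n : ℕ) (hn : 0 < n) (p D N Cdim cdim : ℝ) (hp : 1 ≤ p) (hD : 0 < D) (hN : 1 ≤ N) :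
    ∃ C : ℝ, 0 < C ∧
      ∀ Ω : Set (Rn n), IsOpen Ω → IsConnected Ω → Bornology.IsBounded Ω →
      ∀ B : BomanDecomp n Ω Cdim cdim N,
      ∀ w : Rn n → ℝ, LocallyIntegrableOn w Ω volume →
        (∀ᵐ x ∂(volume : Measure (Rn n)), x ∈ Ω → 0 < w x) →
        DoublingIn Ω w D →
      ∀ u : Rn n → ℝ, LocallyIntegrableOn u Ω (wMeasure w) →
        (∫⁻ x in Ω,
            (ENNReal.ofReal |u x - wAvg w (Qstar B.toWhitneyDecomp B.central) u|) ^ p *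
              ENNReal.ofReal (w x)) ≤
          ENNReal.ofReal C *
            ∑' Q : B.cubes,
              ∫⁻ x in Qstar B.toWhitneyDecomp Q.1,
                (ENNReal.ofReal |u x - wAvg w (Qstar B.toWhitneyDecomp Q.1) u|) ^ p *
                  ENNReal.ofReal (w x) := by
  set Δ : ℝ≥0∞ := max 1 (ENNReal.ofReal D) with hΔdef
  have hΔ : Δ ≠ ⊤ := by simp [hΔdef]
  obtain ⟨m, hm⟩ := pow_unbounded_of_one_lt
    (max (17 * (1 + (1 + Cdim * (n + Cdim + 1)))) N) (one_lt_two (α := ℝ))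
  have hC := localToGlobalConst_ne_top hp hΔ m
  refine ⟨(localToGlobalConst p Δ m).toReal,
    ENNReal.toReal_pos (localToGlobalConst_ne_zero Δ m) hC, ?_⟩
  intro Ω hΩ _ hb B w hw hpos hdoub u hu
  set ν := (wMeasure w).restrict Ω with hν
  have hd : ∀ x ∈ Ω, ∀ r : ℝ, 0 < r → ν (CubeC x (2 * r)) ≤ Δ * ν (CubeC x r) := by
    intro x hx r hr
    rw [wMeasure_restrict_apply w hΩ.measurableSet (measurableSet_CubeC _ _),
      wMeasure_restrict_apply w hΩ.measurableSet (measurableSet_CubeC _ _)]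
    refine (hdoub x hx r hr).trans ?_
    gcongr
    exact le_max_right _ _
  have hfinite : IsFiniteMeasure ν :=
    isFiniteMeasure_wMeasure_restrict B.toWhitneyDecomp hΩ hb hw hΔ hd B.central_mem
  have hum : AEMeasurable u ν := hu.aestronglyMeasurable.aemeasurable
  have hedist : ∀ a b : ℝ, ENNReal.ofReal |a - b| = edist a b := fun a b => by
    rw [edist_dist, Real.dist_eq]
  simp_rw [hedist]
  have hmain := B.setLIntegral_edist_rpow_le (ν := ν) hΩ hd (le_max_left _ _) hΔ hN
    ((le_max_left _ _).trans hm.le) ((le_max_right _ _).trans hm.le) hp hum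
    (fun Q => wAvg w (Qstar B.toWhitneyDecomp Q) u)
    (fun P hP => wMeasure_restrict_ne_zero hΩ.measurableSet hw hpos (B.measurableSet hP)
      (B.subset_domain hP) (B.volume_ne_zero hP))
  have hmeas : ∀ b : ℝ, AEMeasurable (fun x => edist (u x) b ^ p) ν := fun b =>
    (hum.edist aemeasurable_const).pow_const p
  rw [ENNReal.ofReal_toReal hC,
    setLIntegral_mul_ofReal_eq hw (hmeas _) hΩ.measurableSet subset_rfl]
  refine hmain.trans (le_of_eq ?_)
  congr 1
  refine tsum_congr fun Q => ?_
  rw [setLIntegral_mul_ofReal_eq hw (hmeas _) (B.measurableSet_Qstar Q)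
    (B.Qstar_subset hΩ Q.2)]
  rfl
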